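/- arXiv:1608.00352 — 3 statements merged into one kernel-verified Lean document; each statement's English description precedes it below -/
import Mathlib

section
/- Let M₀, M₁ be natural numbers with M = M₀ + M₁ ≥ 1, let κ = M₀/M, let α ∈ (0,1], let p_u > 0, and let β₁,…,β_N > 0 with a fixed user index n. Then the simplified SINR of Theorem 1 lower-bounds the exact SINR expression obtained from the moment computations, i.e. M·(α+(1−α)κ)·β_n / (1/p_u + Σ_{i≠n} β_i + 2α(1−α)(1−κ)β_n/(α+(1−α)κ)) ≤ p_u·β_n²·((M₀²+M₀) + 2α·M₀·M₁ + α²·(M₁²+M₁)) / ( p_u·Σ_{i≠n} β_n β_i (M₀ + α² M₁) + β_n M₀ + α² β_n M₁ + α(1−α) M₁ (β_n + p_u β_n Σ_{i=1}^N β_i + p_u β_n²) ), with the two sides having equal denominators after clearing, the gap coming from the nonnegative term p_u β_n (M₀ + α² M₁) in the numerator. -/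
open Finset

/-- For a mixed-ADC massive MIMO uplink with `M₀` full-resolution-ADC
antennas and `M₁` low-resolution-ADC antennas (`M = M₀ + M₁ ≥ 1`, `κ = M₀/M`),
quantization coefficient `α ∈ (0,1]`, transmit power `p_u > 0` and positive
large-scale fading coefficients `β₁,…,β_N`, the simplified SINR of Theorem 1
lower-bounds the exact SINR obtained from the moment computations (eq. (16)). -/
theorem simplified_SINR_le_exact_SINR
    (N : ℕ) (M₀ M₁ : ℕ) (hM : 1 ≤ M₀ + M₁)
    (M κ : ℝ) (hMdef : M = (M₀ : ℝ) + (M₁ : ℝ)) (hκdef : κ = (M₀ : ℝ) / M)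
    (α : ℝ) (hα : α ∈ Set.Ioc (0 : ℝ) 1) (pu : ℝ) (hpu : 0 < pu)
    (β : Fin N → ℝ) (hβ : ∀ i, 0 < β i) (n : Fin N) :
    M * (α + (1 - α) * κ) * β n /
        (1 / pu + ∑ i ∈ Finset.univ.erase n, β i
          + 2 * α * (1 - α) * (1 - κ) * β n / (α + (1 - α) * κ))
      ≤ pu * (β n) ^ 2 *
          (((M₀ : ℝ) ^ 2 + (M₀ : ℝ)) + 2 * α * (M₀ : ℝ) * (M₁ : ℝ)
            + α ^ 2 * ((M₁ : ℝ) ^ 2 + (M₁ : ℝ))) /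
        (pu * ∑ i ∈ Finset.univ.erase n, β n * β i * ((M₀ : ℝ) + α ^ 2 * (M₁ : ℝ))
          + β n * (M₀ : ℝ) + α ^ 2 * β n * (M₁ : ℝ)
          + α * (1 - α) * (M₁ : ℝ) *
              (β n + pu * β n * ∑ i, β i + pu * (β n) ^ 2)) := by
  obtain ⟨hα0, hα1⟩ := hα
  have hM' : (1 : ℝ) ≤ M₀ + M₁ := mod_cast hM
  have hMne : M ≠ 0 := by linarith
  have hM₀ : (0 : ℝ) ≤ M₀ := M₀.cast_nonneg
  have hM₁ : (0 : ℝ) ≤ M₁ := M₁.cast_nonneg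
  have hb := hβ n
  have hS : 0 ≤ ∑ i ∈ Finset.univ.erase n, β i := Finset.sum_nonneg fun i _ => (hβ i).le
  have hA : 0 < (M₀ : ℝ) + α * M₁ := by nlinarith
  have hgain : α + (1 - α) * κ = (M₀ + α * M₁) / M := by
    rw [hκdef, eq_div_iff hMne]
    field_simp
    rw [hMdef]
    ring
  have hκ : 1 - κ = M₁ / M := by
    rw [hκdef, eq_div_iff hMne]
    field_simp
    rw [hMdef]
    ring
  rw [← Finset.add_sum_erase _ β (Finset.mem_univ n), ← Finset.sum_mul, ← Finset.mul_sum,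
    hgain, hκ]
  generalize ∑ i ∈ Finset.univ.erase n, β i = S at hS ⊢
  generalize β n = b at hb ⊢
  have hα' : 0 ≤ 1 - α := sub_nonneg.mpr hα1
  have hD : 0 < (pu * S + 1) * (M₀ + α * M₁) + 2 * pu * α * (1 - α) * M₁ * b := by positivity
  have hlhs : M * ((M₀ + α * M₁) / M) * b /
        (1 / pu + S + 2 * α * (1 - α) * (M₁ / M) * b / ((M₀ + α * M₁) / M))
      = pu * b ^ 2 * (M₀ + α * M₁) ^ 2 /
        (b * ((pu * S + 1) * (M₀ + α * M₁) + 2 * pu * α * (1 - α) * M₁ * b)) := by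
    have hden : 1 / pu + S + 2 * α * (1 - α) * (M₁ / M) * b / ((M₀ + α * M₁) / M)
        = ((pu * S + 1) * (M₀ + α * M₁) + 2 * pu * α * (1 - α) * M₁ * b) /
          (pu * (M₀ + α * M₁)) := by
      field_simp
      ring
    rw [hden, mul_div_cancel₀ _ hMne]
    field_simp
  have hrhs : pu * (b * S * (M₀ + α ^ 2 * M₁)) + b * M₀ + α ^ 2 * b * M₁
        + α * (1 - α) * M₁ * (b + pu * b * (b + S) + pu * b ^ 2)
      = b * ((pu * S + 1) * (M₀ + α * M₁) + 2 * pu * α * (1 - α) * M₁ * b) := by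
    ring
  rw [hlhs, hrhs]
  gcongr
  nlinarith [mul_nonneg (sq_nonneg α) hM₁]
end

section
/- Fix a real M > 0, α ∈ (0,1), p_u > 0, and β₁,…,β_N > 0 with a fixed user index n. Then the function κ ↦ SINR(M,κ,α,p_u) = M·(α+(1−α)κ)·β_n / (1/p_u + Σ_{i≠n} β_i + 2α(1−α)(1−κ)β_n/(α+(1−α)κ)) is strictly increasing on the interval [0,1]; consequently the approximate spectral efficiency R̃_n = log₂(1 + SINR) is strictly increasing in the proportion κ of full-resolution ADCs. -/
open Finset

/-- The approximate SINR of Theorem 1 for user `n`. -/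
noncomputable def mixedADC_SINR (N : ℕ) (β : Fin N → ℝ) (n : Fin N)
    (M κ α pu : ℝ) : ℝ :=
  M * (α + (1 - α) * κ) * β n /
    (1 / pu + ∑ i ∈ Finset.univ.erase n, β i
      + 2 * α * (1 - α) * (1 - κ) * β n / (α + (1 - α) * κ))

/-- The approximate achievable spectral efficiency `R̃_n` of Theorem 1. -/
noncomputable def mixedADC_SE (N : ℕ) (β : Fin N → ℝ) (n : Fin N)
    (M κ α pu : ℝ) : ℝ :=
  Real.logb 2 (1 + mixedADC_SINR N β n M κ α pu)

/-- The effective gain `α + (1 - α) κ` is positive for `α ∈ (0,1)` and `κ ≥ 0`. -/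
lemma mixedADC_gain_pos {α κ : ℝ} (hα : α ∈ Set.Ioo (0 : ℝ) 1) (hκ : 0 ≤ κ) :
    0 < α + (1 - α) * κ :=
  add_pos_of_pos_of_nonneg hα.1 (mul_nonneg (sub_nonneg.2 hα.2.le) hκ)

/-- The denominator of the SINR is positive. -/
lemma mixedADC_denom_pos {N : ℕ} {β : Fin N → ℝ} (hβ : ∀ i, 0 < β i) (n : Fin N)
    {α κ pu : ℝ} (hα : α ∈ Set.Ioo (0 : ℝ) 1) (hpu : 0 < pu) (hκ : κ ∈ Set.Icc (0 : ℝ) 1) :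
    0 < 1 / pu + ∑ i ∈ Finset.univ.erase n, β i
      + 2 * α * (1 - α) * (1 - κ) * β n / (α + (1 - α) * κ) := by
  have hsum : 0 ≤ ∑ i ∈ Finset.univ.erase n, β i := Finset.sum_nonneg fun i _ => (hβ i).le
  have hgain := mixedADC_gain_pos hα hκ.1
  have hα₀ := hα.1
  have hα₁ : 0 < 1 - α := sub_pos.2 hα.2
  have hκ₁ : 0 ≤ 1 - κ := sub_nonneg.2 hκ.2
  have hβn := hβ n
  positivity

lemma mixedADC_SINR_pos {N : ℕ} {β : Fin N → ℝ} (hβ : ∀ i, 0 < β i) (n : Fin N)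
    {M α κ pu : ℝ} (hM : 0 < M) (hα : α ∈ Set.Ioo (0 : ℝ) 1) (hpu : 0 < pu)
    (hκ : κ ∈ Set.Icc (0 : ℝ) 1) : 0 < mixedADC_SINR N β n M κ α pu :=
  div_pos (mul_pos (mul_pos hM (mixedADC_gain_pos hα hκ.1)) (hβ n))
    (mixedADC_denom_pos hβ n hα hpu hκ)

lemma mixedADC_SINR_strictMonoOn {N : ℕ} {β : Fin N → ℝ} (hβ : ∀ i, 0 < β i) (n : Fin N)
    {M α pu : ℝ} (hM : 0 < M) (hα : α ∈ Set.Ioo (0 : ℝ) 1) (hpu : 0 < pu) :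
    StrictMonoOn (fun κ => mixedADC_SINR N β n M κ α pu) (Set.Icc 0 1) := by
  intro x hx y hy hxy
  have hα₀ := hα.1
  have hα₁ : 0 < 1 - α := sub_pos.2 hα.2
  have hβn := hβ n
  have hgx := mixedADC_gain_pos hα hx.1
  have hgy := mixedADC_gain_pos hα hy.1
  have hx₁ : 0 ≤ 1 - x := sub_nonneg.2 hx.2
  refine div_lt_div₀ ?_ ?_ (by positivity) (mixedADC_denom_pos hβ n hα hpu hy)
  · gcongr
  · gcongr

/-- For fixed `M > 0`, `α ∈ (0,1)`, `p_u > 0` and positive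
large-scale fading coefficients, the SINR of Theorem 1 is strictly increasing
in the proportion `κ ∈ [0,1]` of full-resolution ADCs, and consequently so is
the approximate spectral efficiency `R̃_n`. -/
theorem mixedADC_SINR_SE_strictMonoOn_kappa
    (N : ℕ) (β : Fin N → ℝ) (hβ : ∀ i, 0 < β i) (n : Fin N)
    (M : ℝ) (hM : 0 < M) (α : ℝ) (hα : α ∈ Set.Ioo (0 : ℝ) 1)
    (pu : ℝ) (hpu : 0 < pu) :
    StrictMonoOn (fun κ => mixedADC_SINR N β n M κ α pu) (Set.Icc 0 1) ∧
    StrictMonoOn (fun κ => mixedADC_SE N β n M κ α pu) (Set.Icc 0 1) := by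
  have hmono := mixedADC_SINR_strictMonoOn hβ n hM hα hpu
  refine ⟨hmono, fun x hx y hy hxy => ?_⟩
  have hpos := mixedADC_SINR_pos hβ n hM hα hpu hx
  exact Real.logb_lt_logb one_lt_two (by positivity) (add_lt_add_right (hmono hx hy hxy) 1)
end

section
/- Fix M > 0, κ ∈ [0,1], α ∈ (0,1], and β₁,…,β_N > 0 with a fixed user index n. Then the function p_u ↦ R̃_n(M,κ,α,p_u) is strictly increasing on (0,∞); i.e. the approximate spectral efficiency strictly increases with the user transmit power, regardless of the values of κ and α. -/
open Finset

/-- The approximate spectral efficiency strictly increases with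
the user transmit power `p_u`, regardless of the values of `κ` and `α`. -/
theorem mixedADC_SE_strictMonoOn_power
    (N : ℕ) (β : Fin N → ℝ) (hβ : ∀ i, 0 < β i) (n : Fin N)
    (M : ℝ) (hM : 0 < M) (κ : ℝ) (hκ : κ ∈ Set.Icc (0 : ℝ) 1)
    (α : ℝ) (hα : α ∈ Set.Ioc (0 : ℝ) 1) :
    StrictMonoOn (fun pu => mixedADC_SE N β n M κ α pu) (Set.Ioi 0) := by
  obtain ⟨hκ0, hκ1⟩ := hκ
  obtain ⟨hα0, hα1⟩ := hα
  intro p (hp : 0 < p) q (hq : 0 < q) hpq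
  have hn := hβ n
  have h1α : 0 ≤ 1 - α := sub_nonneg.2 hα1
  have h1κ : 0 ≤ 1 - κ := sub_nonneg.2 hκ1
  have hgain : 0 < α + (1 - α) * κ := by positivity
  have hsum : 0 ≤ ∑ i ∈ Finset.univ.erase n, β i := Finset.sum_nonneg fun i _ => (hβ i).le
  have hquant : 0 ≤ 2 * α * (1 - α) * (1 - κ) * β n / (α + (1 - α) * κ) := by positivity
  have hinv : 1 / q < 1 / p := one_div_lt_one_div_of_lt hp hpq
  have hq' : 0 < 1 / q := one_div_pos.2 hq
  have hden : 0 < 1 / q + ∑ i ∈ Finset.univ.erase n, β i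
      + 2 * α * (1 - α) * (1 - κ) * β n / (α + (1 - α) * κ) := by linarith
  have hSINR : mixedADC_SINR N β n M κ α p < mixedADC_SINR N β n M κ α q :=
    div_lt_div_of_pos_left (by positivity) hden (by linarith)
  have hpos : 0 ≤ mixedADC_SINR N β n M κ α p :=
    div_nonneg (by positivity) (by linarith)
  exact Real.logb_lt_logb one_lt_two (by linarith) (by linarith)
end
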